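/- arXiv:2408.12291 — 2 statements merged into one kernel-verified Lean document; each statement's English description precedes it below -/
import Mathlib

section
/- Suppose that for every X ⊆ S there exists an ordinary retraction of A_M onto the standard parabolic subgroup A_X, i.e. a retraction ρ onto A_X such that for every s ∈ S, ρ(s) is either the identity element or the image in A_M of some generator t ∈ S. If a, b, c ∈ S are pairwise distinct and both M a b and M b c are finite and odd, then M a c is also finite and odd. -/
/-- `altProd u v m` is the alternating product `u * v * u * v * ⋯` with `m` factors. -/
def altProd {G : Type*} [Monoid G] : G → G → ℕ → G
  | _, _, 0 => 1
  | u, v, n + 1 => u * altProd v u n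

/-- The relation set of the Artin group of the labelled Coxeter matrix `M`
(label `⊤` meaning no relation). -/
def ArtinRels {S : Type*} (M : S → S → ℕ∞) : Set (FreeGroup S) :=
  { r | ∃ (s t : S) (m : ℕ), s ≠ t ∧ M s t = (m : ℕ∞) ∧
        r = altProd (FreeGroup.of s) (FreeGroup.of t) m *
            (altProd (FreeGroup.of t) (FreeGroup.of s) m)⁻¹ }

/-- The Artin group of the labelled Coxeter matrix `M`. -/
abbrev ArtinGroup {S : Type*} (M : S → S → ℕ∞) :=
  PresentedGroup (ArtinRels M)

/-- The image in the Artin group of the generator `s`. -/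
def agen {S : Type*} (M : S → S → ℕ∞) (s : S) : ArtinGroup M :=
  PresentedGroup.of s

/-- The standard parabolic subgroup of the Artin group generated by `X ⊆ S`. -/
def parabolic {S : Type*} (M : S → S → ℕ∞) (X : Set S) : Subgroup (ArtinGroup M) :=
  Subgroup.closure (agen M '' X)

/-- The conjugate `g H g⁻¹` of a subgroup `H`. -/
def conjSub {G : Type*} [Group G] (g : G) (H : Subgroup G) : Subgroup G :=
  H.map (MulAut.conj g).toMonoidHom

/-- `ρ` is a retraction of `G` onto its subgroup `H`: its image is contained in `H`
and it fixes every element of `H`. -/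
def IsRetraction {G : Type*} [Group G] (ρ : G →* G) (H : Subgroup G) : Prop :=
  (∀ g, ρ g ∈ H) ∧ ∀ h ∈ H, ρ h = h

/-- The extended natural number `x` is finite and odd. -/
def OddLab (x : ℕ∞) : Prop := ∃ m : ℕ, x = (m : ℕ∞) ∧ Odd m

/-- The extended natural number `x` is finite and even. -/
def EvenFin (x : ℕ∞) : Prop := ∃ m : ℕ, x = (m : ℕ∞) ∧ Even m

/-- The extended natural number `x` is even or equal to `∞`. -/
def EvenOrInf (x : ℕ∞) : Prop := ∀ m : ℕ, x = (m : ℕ∞) → Even m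

theorem map_altProd {G H : Type*} [Monoid G] [Monoid H] (φ : G →* H) (x y : G) (m : ℕ) :
    φ (altProd x y m) = altProd (φ x) (φ y) m := by
  induction m generalizing x y with
  | zero => exact map_one φ
  | succ m ih => simp only [altProd, map_mul, ih]

theorem altProd_two_mul {G : Type*} [Monoid G] (x y : G) (k : ℕ) :
    altProd x y (2 * k) = (x * y) ^ k := by
  induction k with
  | zero => simp [altProd]
  | succ k ih =>
    rw [show 2 * (k + 1) = 2 * k + 1 + 1 by ring, altProd, altProd, ih, pow_succ', mul_assoc]

theorem altProd_two_mul_add_one {G : Type*} [Monoid G] (x y : G) (k : ℕ) :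
    altProd x y (2 * k + 1) = (x * y) ^ k * x := by
  rw [altProd, altProd_two_mul, mul_pow_mul]

theorem Commute.eq_of_altProd_eq {G : Type*} [Group G] {x y : G} (hxy : Commute x y) {m : ℕ}
    (hm : Odd m) (h : altProd x y m = altProd y x m) : x = y := by
  obtain ⟨k, rfl⟩ := hm
  rw [altProd_two_mul_add_one, altProd_two_mul_add_one, hxy.eq] at h
  exact mul_left_cancel h

theorem Commute.altProd_eq_of_even {G : Type*} [Monoid G] {x y : G} (hxy : Commute x y) {m : ℕ}
    (hm : Even m) : altProd x y m = altProd y x m := by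
  obtain ⟨k, rfl⟩ := hm
  rw [← two_mul, altProd_two_mul, altProd_two_mul, hxy.eq]

theorem altProd_eq_of_mul_pow_eq_one {G : Type*} [Group G] {x y : G} (hx : x⁻¹ = x)
    (hy : y⁻¹ = y) {m : ℕ} (hm : Odd m) (h : (x * y) ^ m = 1) :
    altProd x y m = altProd y x m := by
  obtain ⟨k, rfl⟩ := hm
  have hyx : y * x = (x * y)⁻¹ := by rw [mul_inv_rev, hx, hy]
  rw [altProd_two_mul_add_one, altProd_two_mul_add_one, hyx, inv_pow, eq_inv_mul_iff_mul_eq,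
    ← mul_assoc, ← pow_add, ← two_mul, ← mul_right_cancel_iff (a := y), mul_assoc, ← pow_succ, h]
  nth_rewrite 1 [← hy]
  exact (inv_mul_cancel y).symm

theorem agen_relation {S : Type*} {M : S → S → ℕ∞} {s t : S} (hst : s ≠ t) {m : ℕ}
    (hm : M s t = m) :
    altProd (agen M s) (agen M t) m = altProd (agen M t) (agen M s) m := by
  have h := PresentedGroup.one_of_mem (rels := ArtinRels M) ⟨s, t, m, hst, hm, rfl⟩
  rw [map_mul, map_inv, mul_inv_eq_one, map_altProd, map_altProd] at h
  exact h

open Polynomial.Chebyshev in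
/-- The consecutive Chebyshev values governing a product of two reflections at angle `π / m`
cancel when `m` is odd. -/
theorem chebyshev_S_add_S_eq_zero {k : ℕ} (hk : 0 < k) {t : ℝ}
    (ht : t = 2 * Real.cos (2 * Real.pi / (2 * k + 1))) :
    (S ℝ k).eval t + (S ℝ (k - 1)).eval t = 0 := by
  have hk' : (1 : ℝ) ≤ k := by exact_mod_cast hk
  set θ := 2 * Real.pi / (2 * k + 1) with hθ
  have hθm : θ * (2 * k + 1) = 2 * Real.pi := by rw [hθ]; field_simp
  have hsin : Real.sin θ ≠ 0 := by
    refine (Real.sin_pos_of_pos_of_lt_pi (by positivity) ?_).ne'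
    rw [hθ, div_lt_iff₀ (by positivity)]
    nlinarith [Real.pi_pos]
  refine (mul_eq_zero.1 ?_).resolve_right hsin
  rw [add_mul, ht, S_two_mul_real_cos, S_two_mul_real_cos]
  push_cast
  rw [show ((k : ℝ) + 1) * θ = 2 * Real.pi - ((k : ℝ) - 1 + 1) * θ by linarith,
    Real.sin_two_pi_sub]
  ring

theorem Module.reflection_mul_reflection_pow_eq_one_of_odd {V : Type*} [AddCommGroup V]
    [Module ℝ V] {x y : V} {f g : Module.Dual ℝ V} (hf : f x = 2) (hg : g y = 2) {m : ℕ}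
    (hm : Odd m) (hm1 : m ≠ 1) (hfy : f y = -2 * Real.cos (Real.pi / m))
    (hgx : g x = -2 * Real.cos (Real.pi / m)) :
    (Module.reflection hf * Module.reflection hg) ^ m = 1 := by
  obtain ⟨k, rfl⟩ := hm
  have ht : f y * g x - 2 = 2 * Real.cos (2 * Real.pi / (2 * k + 1)) := by
    rw [hfy, hgx, mul_div_assoc, Real.cos_two_mul]
    push_cast
    ring
  have hS := chebyshev_S_add_S_eq_zero (k := k) (by lia) ht
  ext z
  rw [Module.reflection_mul_reflection_pow_apply hf hg]
  have h1 : (((2 * k + 1 : ℕ) : ℤ) - 1) / 2 = k := by lia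
  have h2 : (((2 * k + 1 : ℕ) : ℤ) - 2) / 2 = k - 1 := by lia
  have h3 : (((2 * k + 1 : ℕ) : ℤ) - 3) / 2 = k - 1 := by lia
  have h4 : ((2 * k + 1 : ℕ) : ℤ) / 2 = k := by lia
  rw [h1, h2, h3, h4, hS]
  simp

theorem Module.commute_reflection {R V : Type*} [CommRing R] [AddCommGroup V] [Module R V]
    {x y : V} {f g : Module.Dual R V} (hf : f x = 2) (hg : g y = 2) (hfy : f y = 0)
    (hgx : g x = 0) : Commute (Module.reflection hf) (Module.reflection hg) := by
  ext z
  simp only [LinearEquiv.mul_apply, Module.reflection_apply, map_sub, map_smul, hfy, hgx,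
    zero_smul, sub_zero]
  abel

namespace ArtinGroup

variable {S : Type*} (M : S → S → ℕ∞)

/-- The Cartan-type coefficient `-2 cos (π / M s t)` when `M s t` is finite and odd, and `0`
otherwise. -/
noncomputable def oddCoeff (s t : S) : ℝ :=
  open Classical in if OddLab (M s t) then -2 * Real.cos (Real.pi / (M s t).toNat) else 0

/-- The coroot of the generator `s`. -/
noncomputable def oddCoroot (s : S) : Module.Dual ℝ (S →₀ ℝ) :=
  Finsupp.linearCombination ℝ (oddCoeff M s)

variable {M}

theorem oddCoroot_single (s t : S) : oddCoroot M s (Finsupp.single t 1) = oddCoeff M s t := by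
  simp [oddCoroot]

theorem oddCoeff_of_odd {s t : S} {m : ℕ} (hm : Odd m) (h : M s t = m) :
    oddCoeff M s t = -2 * Real.cos (Real.pi / m) := by
  rw [oddCoeff, if_pos ⟨m, h, hm⟩, h, ENat.toNat_natCast]

theorem oddCoeff_of_not_oddLab {s t : S} (h : ¬ OddLab (M s t)) : oddCoeff M s t = 0 :=
  if_neg h

theorem oddCoroot_single_self (hdiag : ∀ s, M s s = 1) (s : S) :
    oddCoroot M s (Finsupp.single s 1) = 2 := by
  rw [oddCoroot_single, oddCoeff_of_odd odd_one (hdiag s)]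
  simp

/-- The reflection attached to the generator `s`. -/
noncomputable def oddReflection (hdiag : ∀ s, M s s = 1) (s : S) :
    (S →₀ ℝ) ≃ₗ[ℝ] (S →₀ ℝ) :=
  Module.reflection (oddCoroot_single_self hdiag s)

theorem commute_oddReflection (hsymm : ∀ s t, M s t = M t s) (hdiag : ∀ s, M s s = 1) {s t : S}
    (h : ¬ OddLab (M s t)) : Commute (oddReflection hdiag s) (oddReflection hdiag t) :=
  Module.commute_reflection _ _ ((oddCoroot_single s t).trans (oddCoeff_of_not_oddLab h))
    ((oddCoroot_single t s).trans (oddCoeff_of_not_oddLab (hsymm s t ▸ h)))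

theorem altProd_oddReflection (hsymm : ∀ s t, M s t = M t s) (hdiag : ∀ s, M s s = 1)
    (hge2 : ∀ s t, s ≠ t → 2 ≤ M s t) {s t : S} (hst : s ≠ t) {m : ℕ} (hm : M s t = m) :
    altProd (oddReflection hdiag s) (oddReflection hdiag t) m =
      altProd (oddReflection hdiag t) (oddReflection hdiag s) m := by
  rcases Nat.even_or_odd m with he | ho
  · refine (commute_oddReflection hsymm hdiag ?_).altProd_eq_of_even he
    rintro ⟨n, hn, hodd⟩
    obtain rfl : m = n := by exact_mod_cast hm.symm.trans hn
    exact Nat.not_even_iff_odd.2 hodd he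
  · have hm2 : 2 ≤ m := by
      have := hge2 s t hst
      rw [hm] at this
      exact_mod_cast this
    refine altProd_eq_of_mul_pow_eq_one (Module.reflection_inv _) (Module.reflection_inv _) ho ?_
    refine Module.reflection_mul_reflection_pow_eq_one_of_odd _ _ ho (by lia) ?_ ?_
    · rw [oddCoroot_single, oddCoeff_of_odd ho hm]
    · rw [oddCoroot_single, oddCoeff_of_odd ho ((hsymm t s).trans hm)]

/-- The reflection representation of the Artin group in which even and infinite labels are
treated as `2`. -/
noncomputable def oddRep (hsymm : ∀ s t, M s t = M t s) (hdiag : ∀ s, M s s = 1)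
    (hge2 : ∀ s t, s ≠ t → 2 ≤ M s t) : ArtinGroup M →* ((S →₀ ℝ) ≃ₗ[ℝ] (S →₀ ℝ)) :=
  PresentedGroup.toGroup (f := oddReflection hdiag) <| by
    rintro _ ⟨s, t, m, hst, hm, rfl⟩
    rw [map_mul, map_inv, mul_inv_eq_one, map_altProd, map_altProd, FreeGroup.lift_apply_of,
      FreeGroup.lift_apply_of]
    exact altProd_oddReflection hsymm hdiag hge2 hst hm

section

variable (hsymm : ∀ s t, M s t = M t s) (hdiag : ∀ s, M s s = 1)
  (hge2 : ∀ s t, s ≠ t → 2 ≤ M s t)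

theorem oddRep_agen (s : S) :
    oddRep hsymm hdiag hge2 (agen M s) = oddReflection hdiag s :=
  PresentedGroup.toGroup.of _

theorem oddRep_agen_apply_of_ne {s t : S} (hst : s ≠ t) (v : S →₀ ℝ) :
    oddRep hsymm hdiag hge2 (agen M s) v t = v t := by
  simp [oddRep_agen, oddReflection, Module.reflection_apply, hst]

theorem oddRep_agen_single_self (s : S) :
    oddRep hsymm hdiag hge2 (agen M s) (Finsupp.single s 1) s = -1 := by
  rw [oddRep_agen, oddReflection, Module.reflection_apply_self]
  simp

theorem oddRep_apply_of_mem_parabolic {X : Set S} {t : S} (ht : t ∉ X) {g : ArtinGroup M}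
    (hg : g ∈ parabolic M X) (v : S →₀ ℝ) : oddRep hsymm hdiag hge2 g v t = v t := by
  induction hg using Subgroup.closure_induction generalizing v with
  | mem x hx =>
    obtain ⟨s, hs, rfl⟩ := hx
    exact oddRep_agen_apply_of_ne _ _ _ (by rintro rfl; exact ht hs) v
  | one => simp
  | mul x y _ _ hx hy => rw [map_mul, LinearEquiv.mul_apply, hx, hy]
  | inv x _ hx =>
    rw [← hx, ← LinearEquiv.mul_apply, ← map_mul, mul_inv_cancel, map_one]
    rfl

end

theorem mem_of_agen_mem_parabolic (hsymm : ∀ s t, M s t = M t s) (hdiag : ∀ s, M s s = 1)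
    (hge2 : ∀ s t, s ≠ t → 2 ≤ M s t) {X : Set S} {t : S}
    (h : agen M t ∈ parabolic M X) : t ∈ X := by
  by_contra ht
  have h1 := oddRep_apply_of_mem_parabolic hsymm hdiag hge2 ht h (Finsupp.single t 1)
  rw [oddRep_agen_single_self, Finsupp.single_eq_same] at h1
  norm_num at h1

theorem agen_ne_one (hsymm : ∀ s t, M s t = M t s) (hdiag : ∀ s, M s s = 1)
    (hge2 : ∀ s t, s ≠ t → 2 ≤ M s t) (s : S) : agen M s ≠ 1 := fun h =>
  mem_of_agen_mem_parabolic hsymm hdiag hge2 (X := ∅) (h ▸ one_mem _)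

theorem oddLab_of_altProd_eq (hsymm : ∀ s t, M s t = M t s) (hdiag : ∀ s, M s s = 1)
    (hge2 : ∀ s t, s ≠ t → 2 ≤ M s t) {s t : S} (hst : s ≠ t) {m : ℕ}
    (hm : Odd m) (h : altProd (agen M s) (agen M t) m = altProd (agen M t) (agen M s) m) :
    OddLab (M s t) := by
  by_contra hodd
  have h' := congrArg (oddRep hsymm hdiag hge2) h
  rw [map_altProd, map_altProd, oddRep_agen, oddRep_agen] at h'
  have heq := (commute_oddReflection hsymm hdiag hodd).eq_of_altProd_eq hm h'
  have h1 := oddRep_agen_single_self hsymm hdiag hge2 t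
  rw [oddRep_agen, ← heq, ← oddRep_agen hsymm hdiag hge2,
    oddRep_agen_apply_of_ne _ _ _ hst, Finsupp.single_eq_same] at h1
  norm_num at h1

end ArtinGroup

/-- If the Artin group of `M` admits, for every `X ⊆ S`, an ordinary retraction onto
the standard parabolic subgroup `A_X` (a retraction sending every generator to the
identity or to a generator), then for pairwise distinct `a, b, c` with `M a b` and
`M b c` finite and odd, the label `M a c` is also finite and odd. -/
theorem ordinary_retractions_odd_triangle {S : Type*} [Fintype S] (M : S → S → ℕ∞)
    (hsymm : ∀ s t, M s t = M t s) (hdiag : ∀ s, M s s = 1)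
    (hge2 : ∀ s t, s ≠ t → 2 ≤ M s t)
    (hret : ∀ X : Set S, ∃ ρ : ArtinGroup M →* ArtinGroup M,
      IsRetraction ρ (parabolic M X) ∧
      ∀ s : S, ρ (agen M s) = 1 ∨ ∃ t : S, ρ (agen M s) = agen M t)
    (a b c : S) (hab : a ≠ b) (hbc : b ≠ c) (hac : a ≠ c)
    (hMab : OddLab (M a b)) (hMbc : OddLab (M b c)) :
    OddLab (M a c) := by
  obtain ⟨m, hm, hmodd⟩ := hMab
  obtain ⟨n, hn, hnodd⟩ := hMbc
  obtain ⟨ρ, ⟨hmem, hfix⟩, hgen⟩ := hret {a, c}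
  have ha : ρ (agen M a) = agen M a := hfix _ (Subgroup.subset_closure ⟨a, by simp, rfl⟩)
  have hc : ρ (agen M c) = agen M c := hfix _ (Subgroup.subset_closure ⟨c, by simp, rfl⟩)
  have hρab := congrArg ρ (agen_relation hab hm)
  have hρbc := congrArg ρ (agen_relation hbc hn)
  rw [map_altProd, map_altProd, ha] at hρab
  rw [map_altProd, map_altProd, hc] at hρbc
  rcases hgen b with hb | ⟨t, hb⟩
  · rw [hb] at hρab
    exact absurd ((Commute.one_right _).eq_of_altProd_eq hmodd hρab)
      (ArtinGroup.agen_ne_one hsymm hdiag hge2 a)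
  · have ht : t ∈ ({a, c} : Set S) :=
      ArtinGroup.mem_of_agen_mem_parabolic hsymm hdiag hge2 (hb ▸ hmem (agen M b))
    rcases ht with rfl | rfl
    · exact ArtinGroup.oddLab_of_altProd_eq hsymm hdiag hge2 hac hnodd (hb ▸ hρbc)
    · exact ArtinGroup.oddLab_of_altProd_eq hsymm hdiag hge2 hac hmodd (hb ▸ hρab)
end

section
/- Suppose M is (odd, odd)-free and A_M admits ordinary retractions. Let g, h ∈ A_M, X, Y ⊆ S, and Z ⊊ S. If both A_{C_{X,Y}} and g·A_{C_{Y,X}}·g⁻¹ are contained in h·A_Z·h⁻¹, then there exist X', Y' ⊆ Z and f₁, f₂ ∈ A_Z such that h⁻¹·(A_{C_{X,Y}} ∩ g·A_{C_{Y,X}}·g⁻¹)·h = f₁·A_{C_{X',Y'}}·f₁⁻¹ ∩ f₂·A_{C_{Y',X'}}·f₂⁻¹. -/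
/-- `ρ` is the ordinary retraction of the Artin group of `M` onto the standard
parabolic subgroup over `X`: it is a retraction onto `A_X`, it fixes the generators
in `X`, it sends a generator `v ∉ X` joined to some `a ∈ X` by an odd label to `a`,
and it kills the generators `v ∉ X` all of whose labels towards `X` are even or `∞`. -/
def IsOrdinaryRetraction {S : Type*} (M : S → S → ℕ∞) (X : Set S)
    (ρ : ArtinGroup M →* ArtinGroup M) : Prop :=
  IsRetraction ρ (parabolic M X) ∧
  (∀ s ∈ X, ρ (agen M s) = agen M s) ∧
  (∀ v ∉ X, ∀ a ∈ X, OddLab (M v a) → ρ (agen M v) = agen M a) ∧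
  (∀ v ∉ X, (∀ a ∈ X, EvenOrInf (M v a)) → ρ (agen M v) = 1)

/-- `M` has no two consecutive odd-labelled edges. -/
def OddOddFree {S : Type*} (M : S → S → ℕ∞) : Prop :=
  ¬ ∃ s t u : S, s ≠ t ∧ t ≠ u ∧ s ≠ u ∧ OddLab (M s t) ∧ OddLab (M t u)

/-- `O_{X,Y}`: the elements of `X \ Y` joined to some element of `Y \ X` by an
odd label. -/
def Oset {S : Type*} (M : S → S → ℕ∞) (X Y : Set S) : Set S :=
  {x | x ∈ X \ Y ∧ ∃ y ∈ Y \ X, OddLab (M x y)}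

/-- `C_{X,Y} = (X ∩ Y) ∪ O_{X,Y}`. -/
def Cset {S : Type*} (M : S → S → ℕ∞) (X Y : Set S) : Set S :=
  (X ∩ Y) ∪ Oset M X Y

/-- The link of `s`: the vertices joined to `s` by a finite label. -/
def lkset {S : Type*} (M : S → S → ℕ∞) (s : S) : Set S :=
  {t | t ≠ s ∧ M s t ≠ ⊤}

section Conj

variable {G : Type*} [Group G]

theorem conjSub_mul (a b : G) (H : Subgroup G) :
    conjSub (a * b) H = conjSub a (conjSub b H) := by
  simp only [conjSub, Subgroup.map_map]
  congr 1
  ext x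
  simp [mul_assoc]

theorem conjSub_one (H : Subgroup G) : conjSub 1 H = H := by
  ext x
  simp [conjSub]

theorem conjSub_mono (g : G) {H K : Subgroup G} (hHK : H ≤ K) : conjSub g H ≤ conjSub g K :=
  Subgroup.map_mono hHK

theorem conjSub_inf (g : G) (H K : Subgroup G) :
    conjSub g (H ⊓ K) = conjSub g H ⊓ conjSub g K :=
  Subgroup.map_inf H K _ (MulAut.conj g).injective

theorem conjSub_inv_le {g : G} {H K : Subgroup G} (hHK : H ≤ conjSub g K) :
    conjSub g⁻¹ H ≤ K := by
  simpa [← conjSub_mul, conjSub_one] using conjSub_mono g⁻¹ hHK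

theorem map_conjSub (ρ : G →* G) (g : G) (H : Subgroup G) :
    (conjSub g H).map ρ = conjSub (ρ g) (H.map ρ) := by
  simp only [conjSub, Subgroup.map_map]
  congr 1
  ext x
  simp

/-- A retraction onto `H` restricts to the identity on subgroups of `H`. -/
theorem IsRetraction.map_eq {ρ : G →* G} {H K : Subgroup G} (hρ : IsRetraction ρ H)
    (hK : K ≤ H) : K.map ρ = K := by
  ext x
  constructor
  · rintro ⟨y, hy, rfl⟩
    rwa [hρ.2 y (hK hy)]
  · exact fun hx => ⟨x, hx, hρ.2 x (hK hx)⟩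

end Conj

section Artin

variable {S : Type*} {M : S → S → ℕ∞}

theorem map_altProd_s15 {G H : Type*} [Monoid G] [Monoid H] (f : G →* H) (u v : G) (n : ℕ) :
    f (altProd u v n) = altProd (f u) (f v) n := by
  induction n generalizing u v with
  | zero => simp [altProd]
  | succ n ih => simp [altProd, ih]

theorem agen_ne_one (s : S) : agen M s ≠ 1 := by
  intro hs
  have hrel : ∀ r ∈ ArtinRels M,
      FreeGroup.lift (fun _ : S => Multiplicative.ofAdd (1 : ℤ)) r = 1 := by
    rintro r ⟨a, b, m, -, -, rfl⟩
    simp [map_altProd_s15]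
  have := congrArg (PresentedGroup.toGroup hrel) hs
  simp [agen] at this

theorem evenOrInf_of_not_oddLab {x : ℕ∞} (hx : ¬ OddLab x) : EvenOrInf x := by
  intro m hm
  by_contra hodd
  exact hx ⟨m, hm, Nat.not_even_iff_odd.mp hodd⟩

/-- The image in `Z` of the generators in `C` under the ordinary retraction onto `A_Z`. -/
def oddShadow (M : S → S → ℕ∞) (Z C : Set S) : Set S :=
  {z | z ∈ Z ∧ (z ∈ C ∨ ∃ v ∈ C \ Z, OddLab (M v z))}

theorem oddShadow_subset (Z C : Set S) : oddShadow M Z C ⊆ Z := fun _ hz => hz.1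

theorem IsOrdinaryRetraction.map_parabolic {Z C : Set S} {ρ : ArtinGroup M →* ArtinGroup M}
    (hρ : IsOrdinaryRetraction M Z ρ) (hC : ∀ s ∈ C, s ∉ Z → ∃ a ∈ Z, OddLab (M s a)) :
    (parabolic M C).map ρ = parabolic M (oddShadow M Z C) := by
  obtain ⟨-, hfix, hodd, -⟩ := hρ
  rw [parabolic, parabolic, MonoidHom.map_closure]
  congr 1
  ext x
  constructor
  · rintro ⟨_, ⟨s, hs, rfl⟩, rfl⟩
    by_cases hsZ : s ∈ Z
    · exact ⟨s, ⟨hsZ, Or.inl hs⟩, (hfix s hsZ).symm⟩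
    · obtain ⟨a, ha, hsa⟩ := hC s hs hsZ
      exact ⟨a, ⟨ha, Or.inr ⟨s, ⟨hs, hsZ⟩, hsa⟩⟩, (hodd s hsZ a ha hsa).symm⟩
  · rintro ⟨z, ⟨hz, hzC | ⟨v, hv, hvz⟩⟩, rfl⟩
    · exact ⟨_, ⟨z, hzC, rfl⟩, hfix z hz⟩
    · exact ⟨_, ⟨v, hv.1, rfl⟩, hodd v hv.2 z hz hvz⟩

/-- If a conjugate of `A_C` lies in `A_Z`, no generator in `C` is killed by the ordinary
retraction onto `A_Z`. -/
theorem IsOrdinaryRetraction.exists_oddLab {Z C : Set S}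
    {ρ : ArtinGroup M →* ArtinGroup M} (hρ : IsOrdinaryRetraction M Z ρ) {k : ArtinGroup M}
    (hk : conjSub k (parabolic M C) ≤ parabolic M Z) :
    ∀ s ∈ C, s ∉ Z → ∃ a ∈ Z, OddLab (M s a) := by
  intro s hs hsZ
  by_contra! hne
  have hkill := hρ.2.2.2 s hsZ fun a ha => evenOrInf_of_not_oddLab (hne a ha)
  have hfix := hρ.1.2 (k * agen M s * k⁻¹)
    (hk ⟨agen M s, Subgroup.subset_closure ⟨s, hs, rfl⟩, by simp⟩)
  rw [map_mul, map_mul, hkill, mul_one, map_inv, mul_inv_cancel, eq_comm, conj_eq_one_iff] at hfix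
  exact agen_ne_one s hfix

theorem IsOrdinaryRetraction.conjSub_parabolic {Z C : Set S}
    {ρ : ArtinGroup M →* ArtinGroup M} (hρ : IsOrdinaryRetraction M Z ρ) {k : ArtinGroup M}
    (hk : conjSub k (parabolic M C) ≤ parabolic M Z) :
    conjSub k (parabolic M C) = conjSub (ρ k) (parabolic M (oddShadow M Z C)) := by
  rw [← hρ.map_parabolic (hρ.exists_oddLab hk), ← map_conjSub, hρ.1.map_eq hk]

theorem OddOddFree.eq_of_oddLab (hfree : OddOddFree M) {s t u : S} (hst : s ≠ t) (htu : t ≠ u)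
    (h₁ : OddLab (M s t)) (h₂ : OddLab (M t u)) : s = u := by
  by_contra hsu
  exact hfree ⟨s, t, u, hst, htu, hsu, h₁, h₂⟩

theorem Cset_oddShadow (hsymm : ∀ s t, M s t = M t s) (hfree : OddOddFree M) (X Y Z : Set S) :
    Cset M (oddShadow M Z (Cset M X Y)) (oddShadow M Z (Cset M Y X)) =
      oddShadow M Z (Cset M X Y) := by
  have hpartner : ∀ x ∈ X \ Y, ∀ y ∈ Y \ X, OddLab (M x y) → y ∈ Cset M Y X :=
    fun x hx y hy hxy => Or.inr ⟨hy, x, hx, hsymm x y ▸ hxy⟩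
  apply Set.Subset.antisymm
  · rintro z (hz | hz)
    exacts [hz.1, hz.1.1]
  intro z hz
  by_cases hzD : z ∈ oddShadow M Z (Cset M Y X)
  · exact Or.inl ⟨hz, hzD⟩
  refine Or.inr ⟨⟨hz, hzD⟩, ?_⟩
  obtain ⟨hzZ, hzC | ⟨v, ⟨hvC, hvZ⟩, hvz⟩⟩ := hz
  · obtain hzI | ⟨hzX, y, hy, hzy⟩ := hzC
    · exact absurd ⟨hzZ, Or.inl (Or.inl hzI.symm)⟩ hzD
    have hyD := hpartner z hzX y hy hzy
    have hyZ : y ∈ Z := by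
      by_contra hyZ
      exact hzD ⟨hzZ, Or.inr ⟨y, ⟨hyD, hyZ⟩, hsymm z y ▸ hzy⟩⟩
    refine ⟨y, ⟨⟨hyZ, Or.inl hyD⟩, ?_⟩, hzy⟩
    rintro ⟨-, hyC | ⟨v, ⟨-, hvZ⟩, hvy⟩⟩
    · obtain hyI | hyO := hyC
      exacts [hy.2 hyI.1, hy.2 hyO.1.1]
    · have hvz : v = z := hfree.eq_of_oddLab (t := y) (fun e => hvZ (e ▸ hyZ))
        (fun e => hy.2 (e ▸ hzX.1)) hvy (hsymm z y ▸ hzy)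
      exact hvZ (hvz ▸ hzZ)
  · obtain hvI | ⟨hvX, y, hy, hvy⟩ := hvC
    · exact absurd ⟨hzZ, Or.inr ⟨v, ⟨Or.inl hvI.symm, hvZ⟩, hvz⟩⟩ hzD
    have hyz : y = z := hfree.eq_of_oddLab (t := v) (fun e => hy.2 (e ▸ hvX.1))
      (fun e => hvZ (e ▸ hzZ)) (hsymm v y ▸ hvy) hvz
    exact absurd ⟨hzZ, Or.inl (hyz ▸ hpartner v hvX y hy hvy)⟩ hzD

end Artin

/-- In an (odd, odd)-free Artin group admitting ordinary retractions, if
`A_{C_{X,Y}}` and `g A_{C_{Y,X}} g⁻¹` are both contained in a proper parabolic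
subgroup `h A_Z h⁻¹`, then there are `X', Y' ⊆ Z` and `f₁, f₂ ∈ A_Z` with
`h⁻¹ (A_{C_{X,Y}} ∩ g A_{C_{Y,X}} g⁻¹) h
  = f₁ A_{C_{X',Y'}} f₁⁻¹ ∩ f₂ A_{C_{Y',X'}} f₂⁻¹`. -/
theorem restandardisation {S : Type*} [Fintype S] (M : S → S → ℕ∞)
    (hsymm : ∀ s t, M s t = M t s) (hdiag : ∀ s, M s s = 1)
    (hge2 : ∀ s t, s ≠ t → 2 ≤ M s t)
    (hfree : OddOddFree M)
    (hord : ∀ Z : Set S, ∃ ρ : ArtinGroup M →* ArtinGroup M,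
      IsOrdinaryRetraction M Z ρ)
    (g h : ArtinGroup M) (X Y Z : Set S) (hZ : Z ≠ Set.univ)
    (h1 : parabolic M (Cset M X Y) ≤ conjSub h (parabolic M Z))
    (h2 : conjSub g (parabolic M (Cset M Y X)) ≤ conjSub h (parabolic M Z)) :
    ∃ X' Y' : Set S, X' ⊆ Z ∧ Y' ⊆ Z ∧
      ∃ f₁ ∈ parabolic M Z, ∃ f₂ ∈ parabolic M Z,
        conjSub h⁻¹
            (parabolic M (Cset M X Y) ⊓ conjSub g (parabolic M (Cset M Y X))) =
          conjSub f₁ (parabolic M (Cset M X' Y')) ⊓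
            conjSub f₂ (parabolic M (Cset M Y' X')) := by
  obtain ⟨ρ, hρ⟩ := hord Z
  have h1' := conjSub_inv_le h1
  have h2' := conjSub_inv_le h2
  rw [← conjSub_mul] at h2'
  refine ⟨oddShadow M Z (Cset M X Y), oddShadow M Z (Cset M Y X), oddShadow_subset _ _,
    oddShadow_subset _ _, ρ h⁻¹, hρ.1.1 _, ρ (h⁻¹ * g), hρ.1.1 _, ?_⟩
  rw [Cset_oddShadow hsymm hfree, Cset_oddShadow hsymm hfree, conjSub_inf, ← conjSub_mul,
    hρ.conjSub_parabolic h1', hρ.conjSub_parabolic h2']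
end
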